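/- arXiv:1508.06032 — 2 statements merged into one kernel-verified Lean document; each statement's English description precedes it below -/
import Mathlib

section
/- With ρ*_σ := (ρ_σ, ρ̃) and τ*_σ := (τ_σ, τ̃) as constructed, the equilibrium payoff of the zero-sum sequential-move stopping game equals the recursive value at σ: E_σ[U(ρ*_σ⟨τ*_σ⟩, τ*_σ⟨ρ*_σ⟩)] = v_σ almost surely. -/
open MeasureTheory Set

section

variable {Ω : Type*} {m0 : MeasurableSpace Ω} (μ : Measure Ω) (𝓕 : Filtration ℕ m0) (T : ℕ)

/-- `τ ∈ 𝒯`: a stopping time taking values in `{0,…,T}`. -/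
def MemT (τ : Ω → ℕ) : Prop :=
  IsStoppingTime 𝓕 (fun ω => (τ ω : WithTop ℕ)) ∧ ∀ ω, τ ω ≤ T

/-- `τ ∈ 𝒯_t`: a stopping time with `τ ≥ t`. -/
def MemTge (t : ℕ) (τ : Ω → ℕ) : Prop :=
  MemT 𝓕 T τ ∧ ∀ ω, t ≤ τ ω

/-- `τ ∈ 𝒯_{t+}`: a stopping time with `τ ≥ (t+1) ∧ T`. -/
def MemTgePlus (t : ℕ) (τ : Ω → ℕ) : Prop :=
  MemT 𝓕 T τ ∧ ∀ ω, min (t + 1) T ≤ τ ω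

/-- `φ ∈ 𝕋^a`: `φ(t,·) ∈ 𝒯_{t+}` for every stage `t`. -/
def MemTTa (φ : ℕ → Ω → ℕ) : Prop :=
  ∀ t ≤ T, MemTgePlus 𝓕 T t (φ t)

/-- `ψ ∈ 𝕋^b`: `ψ(t,·) ∈ 𝒯_t` for every stage `t`. -/
def MemTTb (ψ : ℕ → Ω → ℕ) : Prop :=
  ∀ t ≤ T, MemTge 𝓕 T t (ψ t)

/-- `ρ = (ρ₀,ρ₁) ∈ 𝔗^a`: a pure stopping strategy of type A. -/
def MemSA (ρ : (Ω → ℕ) × (ℕ → Ω → ℕ)) : Prop :=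
  MemT 𝓕 T ρ.1 ∧ MemTTa 𝓕 T ρ.2

/-- `τ = (τ₀,τ₁) ∈ 𝔗^b`: a pure stopping strategy of type B. -/
def MemSB (τ : (Ω → ℕ) × (ℕ → Ω → ℕ)) : Prop :=
  MemT 𝓕 T τ.1 ∧ MemTTb 𝓕 T τ.2

/-- `ρ⟨τ⟩ = ρ₀ 1_{ρ₀ ≤ τ₀} + ρ₁(τ₀) 1_{ρ₀ > τ₀}`. -/
def adjA (ρ τ : (Ω → ℕ) × (ℕ → Ω → ℕ)) : Ω → ℕ :=
  fun ω => if ρ.1 ω ≤ τ.1 ω then ρ.1 ω else ρ.2 (τ.1 ω) ω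

/-- `τ⟨ρ⟩ = τ₀ 1_{τ₀ < ρ₀} + τ₁(ρ₀) 1_{τ₀ ≥ ρ₀}`. -/
def adjB (τ ρ : (Ω → ℕ) × (ℕ → Ω → ℕ)) : Ω → ℕ :=
  fun ω => if τ.1 ω < ρ.1 ω then τ.1 ω else τ.2 (ρ.1 ω) ω

/-- `w(ρ,τ) = E[U(ρ⟨τ⟩, τ⟨ρ⟩)]`: the payoff of the sequential-move stopping game. -/
noncomputable def w (U : ℕ → ℕ → Ω → ℝ) (ρ τ : (Ω → ℕ) × (ℕ → Ω → ℕ)) : ℝ :=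
  ∫ ω, U (adjA ρ τ ω) (adjB τ ρ ω) ω ∂μ

/-- `inf {t ≥ σ : P(t,·) holds}`, with the convention that the infimum is `T`
if there is no such `t` in `{0,…,T}`. -/
noncomputable def hitTime (T : ℕ) (σ : Ω → ℕ) (P : ℕ → Ω → Prop) : Ω → ℕ :=
  fun ω => sInf ({t | σ ω ≤ t ∧ P t ω} ∪ {T})

theorem aux_sup {Ω' : Type*} {m : MeasurableSpace Ω'} {f g : Ω' → ℝ}
    (hf : StronglyMeasurable f) (hg : StronglyMeasurable g) :
    StronglyMeasurable (fun ω => max (f ω) (g ω)) := hf.sup hg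

theorem aux_inf {Ω' : Type*} {m : MeasurableSpace Ω'} {f g : Ω' → ℝ}
    (hf : StronglyMeasurable f) (hg : StronglyMeasurable g) :
    StronglyMeasurable (fun ω => min (f ω) (g ω)) := hf.inf hg

theorem aux_condExp_congr_on {m : MeasurableSpace Ω} {f g : Ω → ℝ} {s : Set Ω}
    (hs : MeasurableSet[m] s) (hf : Integrable f μ) (hg : Integrable g μ)
    (h : ∀ᵐ ω ∂μ, ω ∈ s → f ω = g ω) :
    ∀ᵐ ω ∂μ, ω ∈ s → (μ[f | m]) ω = (μ[g | m]) ω := by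
  have h1 := condExp_indicator hf hs
  have h2 := condExp_indicator hg hs
  have h3 : s.indicator f =ᵐ[μ] s.indicator g := by
    filter_upwards [h] with ω hω
    by_cases hm : ω ∈ s
    · simp [hm, hω hm]
    · simp [hm]
  have h4 := condExp_congr_ae (m := m) h3
  filter_upwards [h1, h2, h4] with ω h1 h2 h4 hm
  rw [h1, h2] at h4
  simpa [hm] using h4

theorem aux_measurable_comp {β : Type*} [MeasurableSpace β] (f : ℕ → Ω → β)
    (a : Ω → ℕ) (ha : Measurable a) (haT : ∀ ω, a ω ≤ T) (hf : ∀ n ≤ T, Measurable (f n)) :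
    Measurable (fun ω => f (a ω) ω) := by
  have h : Measurable (fun p : Ω × ℕ => f (min p.2 T) p.1) :=
    measurable_from_prod_countable_left fun n => hf _ (min_le_right _ _)
  have h2 := h.comp (measurable_id.prodMk ha)
  convert h2 using 2 with ω
  simp [haT ω]

theorem aux_measurable_comp2 {β : Type*} [MeasurableSpace β] (U : ℕ → ℕ → Ω → β)
    (a b : Ω → ℕ) (ha : Measurable a) (hb : Measurable b) (hU : ∀ s t, Measurable (U s t)) :
    Measurable (fun ω => U (a ω) (b ω) ω) := by
  have h : Measurable (fun p : Ω × (ℕ × ℕ) => U p.2.1 p.2.2 p.1) :=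
    measurable_from_prod_countable_left fun n => hU n.1 n.2
  exact h.comp (measurable_id.prodMk (ha.prodMk hb))

theorem aux_hit_le (σ : Ω → ℕ) (P : ℕ → Ω → Prop) (ω : Ω) : hitTime T σ P ω ≤ T :=
  Nat.sInf_le (Or.inr rfl)

theorem aux_hit_le_of (σ : Ω → ℕ) (P : ℕ → Ω → Prop) (ω : Ω) (t : ℕ) (h : σ ω ≤ t)
    (hP : P t ω) : hitTime T σ P ω ≤ t :=
  Nat.sInf_le (Or.inl ⟨h, hP⟩)

theorem aux_hit_spec (σ : Ω → ℕ) (P : ℕ → Ω → Prop) (ω : Ω) :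
    (σ ω ≤ hitTime T σ P ω ∧ P (hitTime T σ P ω) ω) ∨ hitTime T σ P ω = T :=
  Nat.sInf_mem (s := {t | σ ω ≤ t ∧ P t ω} ∪ {T}) ⟨T, Or.inr rfl⟩

theorem aux_hit_le_iff (σ : Ω → ℕ) (P : ℕ → Ω → Prop) (ω : Ω) (k : ℕ) (hk : k < T) :
    hitTime T σ P ω ≤ k ↔ ∃ s ≤ k, σ ω ≤ s ∧ P s ω := by
  constructor
  · intro h
    rcases aux_hit_spec T σ P ω with h1 | h1
    · exact ⟨_, h, h1⟩
    · omega
  · rintro ⟨s, hs, h1, h2⟩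
    exact (aux_hit_le_of T σ P ω s h1 h2).trans hs

theorem aux_hit_measurable (σ : Ω → ℕ) (P : ℕ → Ω → Prop) (hσ : Measurable σ)
    (hP : ∀ t ≤ T, MeasurableSet {ω | P t ω}) : Measurable (hitTime T σ P) := by
  refine measurable_of_Iic fun k => ?_
  by_cases hk : k < T
  · have : hitTime T σ P ⁻¹' Iic k = ⋃ s ∈ Iic k, ({ω | σ ω ≤ s} ∩ {ω | P s ω}) := by
      ext ω
      simp only [mem_preimage, mem_Iic, aux_hit_le_iff T σ P ω k hk, mem_iUnion, mem_inter_iff,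
        mem_ofPred_eq, exists_prop]
    rw [this]
    refine MeasurableSet.biUnion (to_countable _) fun s hs => ?_
    have hs' : s ≤ k := hs
    exact (measurableSet_le hσ measurable_const).inter (hP s (by omega))
  · have : hitTime T σ P ⁻¹' Iic k = univ := by
      ext ω
      have := aux_hit_le T σ P ω
      simp; omega
    rw [this]; exact MeasurableSet.univ

theorem aux_stopping_measurable {τ : Ω → ℕ}
    (hτ : IsStoppingTime 𝓕 (fun ω => (τ ω : WithTop ℕ))) : Measurable τ := by
  refine measurable_of_Iic fun k => ?_
  have h := 𝓕.le k _ (hτ.measurableSet_le k)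
  convert h using 1
  ext ω
  simp

/-- the equilibrium payoff of the zero-sum sequential-move stopping
game equals the recursive value at `σ`:
`E_σ[U(ρ*_σ⟨τ*_σ⟩, τ*_σ⟨ρ*_σ⟩)] = v_σ` a.s. -/
theorem zero_sum_equilibrium_payoff_eq_value
    [MeasurableSpace.CountablyGenerated Ω] [IsProbabilityMeasure μ]
    (U : ℕ → ℕ → Ω → ℝ)
    (hUm : ∀ s t, Measurable[𝓕 (max s t)] (U s t))
    (hUb : ∃ C, ∀ s t ω, |U s t ω| ≤ C)
    -- stage-wise optimizers `ρ̃(t) ∈ 𝒯_{t+}` and `τ̃(t) ∈ 𝒯_t`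
    (ρtil τtil : ℕ → Ω → ℕ)
    (hρtil : ∀ t ≤ T, MemTgePlus 𝓕 T t (ρtil t))
    (hτtil : ∀ t ≤ T, MemTge 𝓕 T t (τtil t))
    (hρopt : ∀ t ≤ T, ∀ ξ : Ω → ℕ, MemTgePlus 𝓕 T t ξ →
      μ[fun ω => U (ξ ω) t ω | 𝓕 t] ≤ᵐ[μ] μ[fun ω => U (ρtil t ω) t ω | 𝓕 t])
    (hτopt : ∀ t ≤ T, ∀ ξ : Ω → ℕ, MemTge 𝓕 T t ξ →
      μ[fun ω => U t (τtil t ω) ω | 𝓕 t] ≤ᵐ[μ] μ[fun ω => U t (ξ ω) ω | 𝓕 t])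
    -- `F_t = E_t[U(t,τ̃(t))]`, `G_t = E_t[U(ρ̃(t),t)] ∨ F_t`
    (F G v : ℕ → Ω → ℝ)
    (hF : ∀ t, F t = μ[fun ω => U t (τtil t ω) ω | 𝓕 t])
    (hG : ∀ t, G t = fun ω => max ((μ[fun ω' => U (ρtil t ω') t ω' | 𝓕 t]) ω) (F t ω))
    -- the value process, by backward recursion
    (hvT : v T = F T)
    (hvrec : ∀ t < T, v t = fun ω => max (F t ω) (min (G t ω) ((μ[v (t + 1) | 𝓕 t]) ω)))
    -- the initial stage `σ ∈ 𝒯`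
    (σ : Ω → ℕ) (hσ : IsStoppingTime 𝓕 (fun ω => (σ ω : WithTop ℕ))) (hσT : ∀ ω, σ ω ≤ T)
    -- `ρ_σ = inf{t ≥ σ : v_t = F_t}` and `τ_σ = inf{t ≥ σ : v_t = G_t}`
    (ρσ τσ : Ω → ℕ)
    (hρσ : ρσ = hitTime T σ (fun t ω => v t ω = F t ω))
    (hτσ : τσ = hitTime T σ (fun t ω => v t ω = G t ω))
    :
    μ[fun ω => U (adjA (ρσ, ρtil) (τσ, τtil) ω) (adjB (τσ, τtil) (ρσ, ρtil) ω) ω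
        | hσ.measurableSpace] =ᵐ[μ] (fun ω => v (σ ω) ω) := by
  obtain ⟨C, hC⟩ := hUb
  have hUm0 : ∀ s t, Measurable (U s t) := fun s t => (hUm s t).mono (𝓕.le _) le_rfl
  have hUint : ∀ a b : Ω → ℕ, Measurable a → Measurable b →
      Integrable (fun ω => U (a ω) (b ω) ω) μ := fun a b ha hb =>
    Integrable.of_bound (aux_measurable_comp2 U a b ha hb hUm0).aestronglyMeasurable C
      (Filter.Eventually.of_forall fun ω => hC _ _ _)
  have hFm : ∀ t, StronglyMeasurable[𝓕 t] (F t) := fun t => by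
    rw [hF t]; exact stronglyMeasurable_condExp
  have hGm : ∀ t, StronglyMeasurable[𝓕 t] (G t) := fun t => by
    rw [hG t]; exact aux_sup stronglyMeasurable_condExp (hFm t)
  have hFi : ∀ t, Integrable (F t) μ := fun t => by rw [hF t]; exact integrable_condExp
  have hGi : ∀ t, Integrable (G t) μ := fun t => by
    rw [hG t]; exact integrable_condExp.sup (hFi t)
  have hvm : ∀ t ≤ T, StronglyMeasurable[𝓕 t] (v t) := fun t ht => by
    rcases ht.lt_or_eq with h | rfl
    · rw [hvrec t h]; exact aux_sup (hFm t) (aux_inf (hGm t) stronglyMeasurable_condExp)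
    · rw [hvT]; exact hFm _
  have hvi : ∀ t ≤ T, Integrable (v t) μ := fun t ht => by
    rcases ht.lt_or_eq with h | rfl
    · rw [hvrec t h]; exact (hFi t).sup ((hGi t).inf integrable_condExp)
    · rw [hvT]; exact hFi _
  have hvF : ∀ t ≤ T, MeasurableSet[𝓕 t] {ω | v t ω = F t ω} := fun t ht =>
    measurableSet_eq_fun (hvm t ht).measurable (hFm t).measurable
  have hvG : ∀ t ≤ T, MeasurableSet[𝓕 t] {ω | v t ω = G t ω} := fun t ht =>
    measurableSet_eq_fun (hvm t ht).measurable (hGm t).measurable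
  have hσm : Measurable σ := aux_stopping_measurable 𝓕 hσ
  have hρm : Measurable ρσ := by
    rw [hρσ]
    exact aux_hit_measurable T σ _ hσm fun t ht => 𝓕.le t _ (hvF t ht)
  have hτm : Measurable τσ := by
    rw [hτσ]
    exact aux_hit_measurable T σ _ hσm fun t ht => 𝓕.le t _ (hvG t ht)
  have hρtm : ∀ t ≤ T, Measurable (ρtil t) := fun t ht =>
    aux_stopping_measurable 𝓕 (hρtil t ht).1.1
  have hτtm : ∀ t ≤ T, Measurable (τtil t) := fun t ht =>
    aux_stopping_measurable 𝓕 (hτtil t ht).1.1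
  have hρT : ∀ ω, ρσ ω ≤ T := fun ω => by rw [hρσ]; exact aux_hit_le T σ _ ω
  have hτT : ∀ ω, τσ ω ≤ T := fun ω => by rw [hτσ]; exact aux_hit_le T σ _ ω
  have hAm : Measurable (adjA (ρσ, ρtil) (τσ, τtil)) :=
    Measurable.ite (measurableSet_le hρm hτm) hρm (aux_measurable_comp T ρtil τσ hτm hτT hρtm)
  have hBm : Measurable (adjB (τσ, τtil) (ρσ, ρtil)) :=
    Measurable.ite (measurableSet_lt hτm hρm) hτm (aux_measurable_comp T τtil ρσ hρm hρT hτtm)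
  set X : Ω → ℝ := fun ω => U (adjA (ρσ, ρtil) (τσ, τtil) ω) (adjB (τσ, τtil) (ρσ, ρtil) ω) ω
    with hX
  have hXi : Integrable X μ := hUint _ _ hAm hBm
  -- no stopping before `t`
  let N : ℕ → Set Ω := fun t =>
    {ω | σ ω ≤ t ∧ ∀ s < t, σ ω ≤ s → v s ω ≠ F s ω ∧ v s ω ≠ G s ω}
  have hσle : ∀ t, MeasurableSet[𝓕 t] {ω | σ ω ≤ t} := fun t => by
    have h := hσ.measurableSet_le t
    convert h using 1
    ext ω
    simp
  have hN : ∀ t ≤ T, MeasurableSet[𝓕 t] (N t) := fun t ht => by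
    have : N t = {ω | σ ω ≤ t} ∩ ⋂ s ∈ Iio t,
        ({ω | σ ω ≤ s}ᶜ ∪ ({ω | v s ω = F s ω}ᶜ ∩ {ω | v s ω = G s ω}ᶜ)) := by
      ext ω
      simp only [N, mem_ofPred_eq, mem_inter_iff, mem_iInter, mem_union, mem_compl_iff, mem_Iio,
        imp_iff_not_or, ne_eq]
    rw [this]
    refine (hσle t).inter (MeasurableSet.biInter (to_countable _) fun s hs => ?_)
    have hs' : s < t := hs
    refine 𝓕.mono hs'.le _ ?_
    exact (hσle s).compl.union ((hvF s (by omega)).compl.inter (hvG s (by omega)).compl)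
  have hρge : ∀ t ≤ T, ∀ ω ∈ N t, t ≤ ρσ ω := fun t ht ω hω => by
    by_contra! hlt
    have h := aux_hit_spec T σ (fun t ω => v t ω = F t ω) ω
    rw [← hρσ] at h
    rcases h with h | h
    · exact (hω.2 _ hlt h.1).1 h.2
    · omega
  have hτge : ∀ t ≤ T, ∀ ω ∈ N t, t ≤ τσ ω := fun t ht ω hω => by
    by_contra! hlt
    have h := aux_hit_spec T σ (fun t ω => v t ω = G t ω) ω
    rw [← hτσ] at h
    rcases h with h | h
    · exact (hω.2 _ hlt h.1).2 h.2
    · omega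
  have hρle : ∀ t, ∀ ω ∈ N t, v t ω = F t ω → ρσ ω ≤ t := fun t ω hω h => by
    rw [hρσ]; exact aux_hit_le_of T σ _ ω t hω.1 h
  have hτle : ∀ t, ∀ ω ∈ N t, v t ω = G t ω → τσ ω ≤ t := fun t ω hω h => by
    rw [hτσ]; exact aux_hit_le_of T σ _ ω t hω.1 h
  -- case of type-A stop
  have caseF : ∀ t ≤ T, ∀ᵐ ω ∂μ, ω ∈ N t ∩ {ω | v t ω = F t ω} → (μ[X | 𝓕 t]) ω = v t ω := by
    intro t ht
    have := aux_condExp_congr_on μ ((hN t ht).inter (hvF t ht)) hXi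
      (hUint (fun _ => t) (τtil t) measurable_const (hτtm t ht))
      (Filter.Eventually.of_forall fun ω hω => by
        have h1 : ρσ ω = t := le_antisymm (hρle t ω hω.1 hω.2) (hρge t ht ω hω.1)
        have h2 := hτge t ht ω hω.1
        simp [hX, adjA, adjB, h1, h2, Nat.not_lt.mpr h2])
    filter_upwards [this] with ω h hω
    rw [h hω, hω.2, hF t]
  have caseG : ∀ t ≤ T, ∀ᵐ ω ∂μ, ω ∈ N t ∩ ({ω | v t ω = F t ω}ᶜ ∩ {ω | v t ω = G t ω}) →
      (μ[X | 𝓕 t]) ω = v t ω := by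
    intro t ht
    have := aux_condExp_congr_on μ ((hN t ht).inter ((hvF t ht).compl.inter (hvG t ht))) hXi
      (hUint (ρtil t) (fun _ => t) (hρtm t ht) measurable_const)
      (Filter.Eventually.of_forall fun ω hω => by
        have h1 : τσ ω = t := le_antisymm (hτle t ω hω.1 hω.2.2) (hτge t ht ω hω.1)
        have h2 : t < ρσ ω := by
          refine lt_of_le_of_ne (hρge t ht ω hω.1) fun he => hω.2.1 ?_
          have h := aux_hit_spec T σ (fun t ω => v t ω = F t ω) ω
          rw [← hρσ, ← he] at h
          rcases h with h | h
          · exact h.2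
          · subst h
            exact congrFun hvT ω
        simp [hX, adjA, adjB, h1, h2, Nat.not_le.mpr h2])
    filter_upwards [this] with ω h hω
    have h1 : v t ω ≠ F t ω := hω.2.1
    have h2 : v t ω = G t ω := hω.2.2
    rw [h hω]
    have h3 := congrFun (hG t) ω
    rcases max_choice ((μ[fun ω' => U (ρtil t ω') t ω' | 𝓕 t]) ω) (F t ω) with h4 | h4
    · rw [h2, h3, h4]
    · exact absurd (by rw [h2, h3, h4]) h1
  have key : ∀ k t, t + k = T → ∀ᵐ ω ∂μ, ω ∈ N t → (μ[X | 𝓕 t]) ω = v t ω := by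
    intro k
    induction k with
    | zero =>
      intro t ht
      have ht' : t = T := by omega
      subst ht'
      filter_upwards [caseF t le_rfl] with ω h hω
      exact h ⟨hω, congrFun hvT ω⟩
    | succ k ih =>
      intro t ht
      have htT : t < T := by omega
      have ih' := ih (t + 1) (by omega)
      have h1 := aux_condExp_congr_on μ (m := 𝓕 t) (f := μ[X | 𝓕 (t + 1)]) (g := v (t + 1))
        ((hN t htT.le).inter ((hvF t htT.le).compl.inter (hvG t htT.le).compl))
        integrable_condExp (hvi (t + 1) (by omega)) (by
          filter_upwards [ih'] with ω h hω
          refine h ⟨hω.1.1.trans (Nat.le_succ t), fun s hs hσs => ?_⟩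
          rcases (Nat.lt_succ_iff.mp hs).lt_or_eq with h' | rfl
          · exact hω.1.2 s h' hσs
          · exact hω.2)
      have h2 := condExp_condExp_of_le (μ := μ) (f := X) (𝓕.mono (Nat.le_succ t)) (𝓕.le (t + 1))
      filter_upwards [caseF t htT.le, caseG t htT.le, h1, h2] with ω hf hg h1 h2 hω
      by_cases hvf : v t ω = F t ω
      · exact hf ⟨hω, hvf⟩
      by_cases hvg : v t ω = G t ω
      · exact hg ⟨hω, hvf, hvg⟩
      rw [← h2, h1 ⟨hω, hvf, hvg⟩]
      have h3 := congrFun (hvrec t htT) ω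
      rcases max_choice (F t ω) (min (G t ω) ((μ[v (t + 1) | 𝓕 t]) ω)) with h4 | h4
      · exact absurd (h3.trans h4) hvf
      · rcases min_choice (G t ω) ((μ[v (t + 1) | 𝓕 t]) ω) with h5 | h5
        · exact absurd (h3.trans (h4.trans h5)) hvg
        · exact (h3.trans (h4.trans h5)).symm
  have hloc : ∀ t : ℕ, ∀ᵐ ω ∂μ, σ ω = t → (μ[X | hσ.measurableSpace]) ω = (μ[X | 𝓕 t]) ω := by
    intro t
    have h := condExp_stopping_time_ae_eq_restrict_eq_of_countable (μ := μ) (f := X) hσ t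
    rw [Filter.EventuallyEq, ae_restrict_iff' (𝓕.le t _ (hσ.measurableSet_eq_of_countable t))] at h
    filter_upwards [h] with ω h hω
    exact h (by simp [hω])
  have hkey : ∀ᵐ ω ∂μ, ∀ t ≤ T, ω ∈ N t → (μ[X | 𝓕 t]) ω = v t ω := by
    rw [ae_all_iff]
    intro t
    by_cases ht : t ≤ T
    · filter_upwards [key (T - t) t (by omega)] with ω h _ using h
    · exact Filter.Eventually.of_forall fun ω h => absurd h ht
  filter_upwards [hkey, ae_all_iff.mpr hloc] with ω h1 h2
  rw [h2 (σ ω) rfl]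
  exact h1 (σ ω) (hσT ω) ⟨le_rfl, fun s hs hs' => absurd hs' (by omega)⟩

end
end

section
/- The pair of hitting times (ρ_σ, τ_σ) is a saddle point of the discrete-time Dynkin game started at σ: for all stopping times ρ, τ ∈ 𝒯_σ, E_σ[F_ρ 1_{ρ≤τ_σ} + G_{τ_σ} 1_{ρ>τ_σ}] ≤ E_σ[F_{ρ_σ} 1_{ρ_σ≤τ_σ} + G_{τ_σ} 1_{ρ_σ>τ_σ}] ≤ E_σ[F_{ρ_σ} 1_{ρ_σ≤τ} + G_τ 1_{ρ_σ>τ}] almost surely; moreover E_σ[F_{ρ_σ} 1_{ρ_σ≤τ_σ} + G_{τ_σ} 1_{ρ_σ>τ_σ}] = v_σ almost surely. -/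
open MeasureTheory Set

section

variable {Ω : Type*} {m0 : MeasurableSpace Ω} (μ : Measure Ω) (𝓕 : Filtration ℕ m0) (T : ℕ)

/-- The payoff `F_ρ 1_{ρ ≤ τ} + G_τ 1_{ρ > τ}` of the discrete-time Dynkin game. -/
def dynkinGain (F G : ℕ → Ω → ℝ) (ρ τ : Ω → ℕ) : Ω → ℝ :=
  fun ω => if ρ ω ≤ τ ω then F (ρ ω) ω else G (τ ω) ω

/-- The stopped process is integrable. -/
theorem aux_integrable_stopped (u : ℕ → Ω → ℝ) (hui : ∀ t, Integrable (u t) μ)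
    (π : Ω → ℕ) (hπ : IsStoppingTime 𝓕 (fun ω => (π ω : WithTop ℕ))) (hπT : ∀ ω, π ω ≤ T) :
    Integrable (fun ω => u (π ω) ω) μ :=
  integrable_stoppedValue ℕ (N := T) hπ hui (fun ω => WithTop.coe_le_coe.2 (hπT ω))

/-- Local optional sampling inequality. -/
theorem aux_sampling [IsProbabilityMeasure μ] (u : ℕ → Ω → ℝ)
    (hum : ∀ t, StronglyMeasurable[𝓕 t] (u t)) (hui : ∀ t, Integrable (u t) μ)
    (σ π : Ω → ℕ) (hσ : IsStoppingTime 𝓕 (fun ω => (σ ω : WithTop ℕ)))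
    (hπ : IsStoppingTime 𝓕 (fun ω => (π ω : WithTop ℕ)))
    (hσπ : ∀ ω, σ ω ≤ π ω) (hπT : ∀ ω, π ω ≤ T)
    (hstep : ∀ t, ∀ᵐ ω ∂μ, σ ω ≤ t → t < π ω → u t ω ≤ (μ[u (t + 1) | 𝓕 t]) ω) :
    (fun ω => u (σ ω) ω) ≤ᵐ[μ] μ[fun ω => u (π ω) ω | hσ.measurableSpace] := by
  have hm : hσ.measurableSpace ≤ m0 := hσ.measurableSpace_le
  have hiσ := aux_integrable_stopped μ 𝓕 T u hui σ hσ (fun ω => (hσπ ω).trans (hπT ω))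
  have hiπ := aux_integrable_stopped μ 𝓕 T u hui π hπ hπT
  have hmσ : StronglyMeasurable[hσ.measurableSpace] (fun ω => u (σ ω) ω) := by
    have : Measurable[hσ.measurableSpace] (stoppedValue u (fun ω => (σ ω : WithTop ℕ))) :=
      measurable_stoppedValue
        (StronglyAdapted.isStronglyProgressive_of_discrete (u := u) hum) hσ
    exact this.stronglyMeasurable
  refine ae_le_of_ae_le_trim (hm := hm) ?_
  refine ae_le_of_forall_setIntegral_le (hiσ.trim hm hmσ)
    (integrable_condExp.trim hm stronglyMeasurable_condExp) fun A hA _ => ?_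
  rw [← setIntegral_trim hm hmσ hA, ← setIntegral_trim hm stronglyMeasurable_condExp hA,
    setIntegral_condExp hm hiπ hA, ← sub_nonneg,
    ← integral_sub hiπ.integrableOn hiσ.integrableOn]
  have hmD : ∀ t, MeasurableSet[𝓕 t] (A ∩ {ω | σ ω ≤ t ∧ t < π ω}) := by
    intro t
    have h1 := ((hσ.measurableSet A).1 hA).2 t
    have h2 := hπ.measurableSet_gt t
    have h3 := h1.inter h2
    convert h3 using 1
    ext ω
    simp [and_assoc]
  have hmD' : ∀ t, MeasurableSet {ω | σ ω ≤ t ∧ t < π ω} := by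
    intro t
    have h1 := 𝓕.le t _ (hσ.measurableSet_le t)
    have h2 := 𝓕.le t _ (hπ.measurableSet_gt t)
    convert h1.inter h2 using 1
    ext ω
    simp
  have hsum : ∀ ω, u (π ω) ω - u (σ ω) ω = ∑ t ∈ Finset.range T,
      indicator {ω | σ ω ≤ t ∧ t < π ω} (fun ω => u (t + 1) ω - u t ω) ω := by
    intro ω
    have h1 : u (π ω) ω - u (σ ω) ω
        = ∑ t ∈ Finset.Ico (σ ω) (π ω), (u (t + 1) ω - u t ω) := by
      rw [Finset.sum_Ico_sub (fun t => u t ω) (hσπ ω)]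
    rw [h1]
    simp only [indicator_apply, mem_ofPred_eq]
    rw [← Finset.sum_filter]
    refine Finset.sum_congr ?_ fun _ _ => rfl
    ext t
    have := hπT ω
    simp only [Finset.mem_Ico, Finset.mem_filter, Finset.mem_range]
    omega
  simp_rw [hsum]
  rw [integral_finsetSum]
  swap
  · intro t _
    exact (((hui (t + 1)).sub (hui t)).indicator (hmD' t)).integrableOn
  refine Finset.sum_nonneg fun t _ => ?_
  rw [setIntegral_indicator (hmD' t),
    integral_sub (hui (t + 1)).integrableOn (hui t).integrableOn,
    ← setIntegral_condExp (𝓕.le t) (hui (t + 1)) (hmD t), sub_nonneg]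
  refine setIntegral_mono_on_ae (hui t).integrableOn integrable_condExp.integrableOn
    (𝓕.le t _ (hmD t)) ?_
  filter_upwards [hstep t] with ω hω hωD
  exact hω hωD.2.1 hωD.2.2

/-- Hitting times are stopping times. -/
theorem aux_hit_stopping (σ : Ω → ℕ) (hσ : IsStoppingTime 𝓕 (fun ω => (σ ω : WithTop ℕ)))
    (P : ℕ → Ω → Prop) (hP : ∀ t < T, MeasurableSet[𝓕 t] {ω | P t ω}) :
    IsStoppingTime 𝓕 (fun ω => (hitTime T σ P ω : WithTop ℕ)) := by
  intro i
  by_cases hi : T ≤ i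
  · have : {ω | (hitTime T σ P ω : WithTop ℕ) ≤ i} = univ := by
      ext ω
      simp only [mem_ofPred_eq, mem_univ, iff_true]
      have : hitTime T σ P ω ≤ T := Nat.sInf_le (Or.inr rfl)
      exact_mod_cast this.trans hi
    exact this ▸ MeasurableSet.univ
  · push Not at hi
    have : {ω | (hitTime T σ P ω : WithTop ℕ) ≤ i}
        = ⋃ t ∈ Finset.range (i + 1), ({ω | (σ ω : WithTop ℕ) ≤ t} ∩ {ω | P t ω}) := by
      ext ω
      simp only [mem_ofPred_eq, mem_iUnion, Finset.mem_range, mem_inter_iff, Nat.cast_le,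
        exists_prop]
      constructor
      · intro h
        have hmem : hitTime T σ P ω ∈ ({t | σ ω ≤ t ∧ P t ω} ∪ {T} : Set ℕ) :=
          Nat.sInf_mem ⟨T, Or.inr rfl⟩
        rcases hmem with h1 | h1
        · exact ⟨_, by have : hitTime T σ P ω ≤ i := by exact_mod_cast h
                       omega, by exact_mod_cast h1.1, h1.2⟩
        · have h1' : hitTime T σ P ω = T := h1
          have : hitTime T σ P ω ≤ i := by exact_mod_cast h
          omega
      · rintro ⟨t, ht, h1, h2⟩
        have : hitTime T σ P ω ≤ t := Nat.sInf_le (Or.inl ⟨by exact_mod_cast h1, h2⟩)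
        have h3 : hitTime T σ P ω ≤ i := by omega
        exact_mod_cast h3
    show MeasurableSet[𝓕 i] {ω | (hitTime T σ P ω : WithTop ℕ) ≤ i}
    rw [this]
    refine Finset.measurableSet_biUnion _ fun t ht => ?_
    have ht' : t ≤ i := by simpa [Nat.lt_succ_iff] using ht
    exact 𝓕.mono ht' _ ((hσ t).inter (hP t (by omega)))

theorem aux_le_hit (σ : Ω → ℕ) (hσT : ∀ ω, σ ω ≤ T) (P : ℕ → Ω → Prop) (ω : Ω) :
    σ ω ≤ hitTime T σ P ω := by
  have hmem : hitTime T σ P ω ∈ ({t | σ ω ≤ t ∧ P t ω} ∪ {T} : Set ℕ) :=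
    Nat.sInf_mem ⟨T, Or.inr rfl⟩
  rcases hmem with h | h
  · exact h.1
  · have h' : hitTime T σ P ω = T := h
    rw [h']
    exact hσT ω

theorem aux_hit_prop (σ : Ω → ℕ) (P : ℕ → Ω → Prop) (ω : Ω) (hlt : hitTime T σ P ω < T) :
    P (hitTime T σ P ω) ω := by
  have hmem : hitTime T σ P ω ∈ ({t | σ ω ≤ t ∧ P t ω} ∪ {T} : Set ℕ) :=
    Nat.sInf_mem ⟨T, Or.inr rfl⟩
  rcases hmem with h | h
  · exact h.2
  · exact absurd (h : hitTime T σ P ω = T) hlt.ne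

theorem aux_hit_not (σ : Ω → ℕ) (P : ℕ → Ω → Prop) (ω : Ω) (t : ℕ) (h : σ ω ≤ t)
    (hlt : t < hitTime T σ P ω) : ¬ P t ω := fun hp =>
  absurd (Nat.sInf_le (Or.inl ⟨h, hp⟩) : hitTime T σ P ω ≤ t) (not_le.2 hlt)

theorem aux_gain_integrable [IsProbabilityMeasure μ] (F G : ℕ → Ω → ℝ)
    (hF : ∀ t, Integrable (F t) μ) (hG : ∀ t, Integrable (G t) μ) (ρ τ : Ω → ℕ)
    (hρ : IsStoppingTime 𝓕 (fun ω => (ρ ω : WithTop ℕ)))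
    (hτ : IsStoppingTime 𝓕 (fun ω => (τ ω : WithTop ℕ)))
    (hρT : ∀ ω, ρ ω ≤ T) (hτT : ∀ ω, τ ω ≤ T) :
    Integrable (dynkinGain F G ρ τ) μ := by
  have hmeas : ∀ π : Ω → ℕ, IsStoppingTime 𝓕 (fun ω => (π ω : WithTop ℕ)) → Measurable π := by
    intro π hπ
    refine measurable_to_countable' fun n => ?_
    have := 𝓕.le n _ (hπ.measurableSet_eq n)
    convert this using 1
    ext ω
    simp
  have hs : MeasurableSet {ω | ρ ω ≤ τ ω} := measurableSet_le (hmeas ρ hρ) (hmeas τ hτ)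
  have h1 := (aux_integrable_stopped μ 𝓕 T F hF ρ hρ hρT).indicator hs
  have h2 := (aux_integrable_stopped μ 𝓕 T G hG τ hτ hτT).indicator hs.compl
  refine (h1.add h2).congr (Filter.Eventually.of_forall fun ω => ?_)
  by_cases h : ρ ω ≤ τ ω
  · simp [dynkinGain, h]
  · simp [dynkinGain, h]

theorem aux_min_stopping (ρ τ : Ω → ℕ)
    (hρ : IsStoppingTime 𝓕 (fun ω => (ρ ω : WithTop ℕ)))
    (hτ : IsStoppingTime 𝓕 (fun ω => (τ ω : WithTop ℕ))) :
    IsStoppingTime 𝓕 (fun ω => ((min (ρ ω) (τ ω) : ℕ) : WithTop ℕ)) := by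
  intro i
  have h := (hρ i).union (hτ i)
  convert h using 1
  ext ω
  simp

/-- the pair of hitting times `(ρ_σ, τ_σ)` is a saddle point of the
discrete-time Dynkin game started at `σ`, and the corresponding conditional
payoff equals `v_σ` a.s. -/
theorem dynkin_hitting_times_saddle_point
    [IsProbabilityMeasure μ]
    (F G v : ℕ → Ω → ℝ)
    (hFad : ∀ t, Measurable[𝓕 t] (F t)) (hGad : ∀ t, Measurable[𝓕 t] (G t))
    (hFb : ∃ C, ∀ t ω, |F t ω| ≤ C) (hGb : ∃ C, ∀ t ω, |G t ω| ≤ C)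
    (hFG : ∀ t, F t ≤ᵐ[μ] G t)
    (hvT : v T = F T)
    (hvrec : ∀ t < T, v t = fun ω => max (F t ω) (min (G t ω) ((μ[v (t + 1) | 𝓕 t]) ω)))
    (σ : Ω → ℕ) (hσ : IsStoppingTime 𝓕 (fun ω => (σ ω : WithTop ℕ))) (hσT : ∀ ω, σ ω ≤ T)
    (ρσ τσ : Ω → ℕ)
    (hρσ : ρσ = hitTime T σ (fun t ω => v t ω = F t ω))
    (hτσ : τσ = hitTime T σ (fun t ω => v t ω = G t ω)) :
    (∀ ρ : Ω → ℕ, MemT 𝓕 T ρ → (∀ ω, σ ω ≤ ρ ω) →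
      μ[dynkinGain F G ρ τσ | hσ.measurableSpace] ≤ᵐ[μ]
      μ[dynkinGain F G ρσ τσ | hσ.measurableSpace]) ∧
    (∀ τ : Ω → ℕ, MemT 𝓕 T τ → (∀ ω, σ ω ≤ τ ω) →
      μ[dynkinGain F G ρσ τσ | hσ.measurableSpace] ≤ᵐ[μ]
      μ[dynkinGain F G ρσ τ | hσ.measurableSpace]) ∧
    μ[dynkinGain F G ρσ τσ | hσ.measurableSpace] =ᵐ[μ] (fun ω => v (σ ω) ω) := by
  obtain ⟨CF, hCF⟩ := hFb
  obtain ⟨CG, hCG⟩ := hGb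
  have hFi : ∀ t, Integrable (F t) μ := fun t =>
    Integrable.of_bound ((hFad t).mono (𝓕.le t) le_rfl).aestronglyMeasurable CF
      (Filter.Eventually.of_forall fun ω => hCF t ω)
  have hGi : ∀ t, Integrable (G t) μ := fun t =>
    Integrable.of_bound ((hGad t).mono (𝓕.le t) le_rfl).aestronglyMeasurable CG
      (Filter.Eventually.of_forall fun ω => hCG t ω)
  have hvi : ∀ t ≤ T, Integrable (v t) μ := by
    intro t ht
    rcases ht.eq_or_lt with rfl | h
    · rw [hvT]; exact hFi _
    · rw [hvrec t h]
      exact (hFi t).sup ((hGi t).inf integrable_condExp)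
  have hvm : ∀ t ≤ T, Measurable[𝓕 t] (v t) := by
    intro t ht
    rcases ht.eq_or_lt with rfl | h
    · rw [hvT]; exact hFad _
    · rw [hvrec t h]
      exact (hFad t).max ((hGad t).min stronglyMeasurable_condExp.measurable)
  have hFv : ∀ t ≤ T, ∀ ω, F t ω ≤ v t ω := by
    intro t ht ω
    rcases ht.eq_or_lt with rfl | h
    · rw [hvT]
    · rw [hvrec t h]
      exact le_max_left _ _
  have hvG : ∀ᵐ ω ∂μ, ∀ t < T, v t ω ≤ G t ω := by
    filter_upwards [ae_all_iff.2 hFG] with ω hω t ht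
    rw [hvrec t ht]
    exact max_le (hω t) (min_le_left _ _)
  -- the extended process
  let u : ℕ → Ω → ℝ := fun t => v (min t T)
  have hu : ∀ t ≤ T, u t = v t := fun t ht => by simp [u, ht]
  have hum : ∀ t, StronglyMeasurable[𝓕 t] (u t) := fun t =>
    ((hvm _ (min_le_right t T)).mono (𝓕.mono (min_le_left t T)) le_rfl).stronglyMeasurable
  have hui : ∀ t, Integrable (u t) μ := fun t => hvi _ (min_le_right t T)
  have hρs : IsStoppingTime 𝓕 (fun ω => (ρσ ω : WithTop ℕ)) := by
    rw [hρσ]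
    exact aux_hit_stopping 𝓕 T σ hσ _ fun t ht =>
      measurableSet_eq_fun (hvm t ht.le) (hFad t)
  have hτs : IsStoppingTime 𝓕 (fun ω => (τσ ω : WithTop ℕ)) := by
    rw [hτσ]
    exact aux_hit_stopping 𝓕 T σ hσ _ fun t ht =>
      measurableSet_eq_fun (hvm t ht.le) (hGad t)
  have hρT : ∀ ω, ρσ ω ≤ T := fun ω => hρσ ▸ aux_hit_le T σ _ ω
  have hτT : ∀ ω, τσ ω ≤ T := fun ω => hτσ ▸ aux_hit_le T σ _ ω
  have hσρ : ∀ ω, σ ω ≤ ρσ ω := fun ω => hρσ ▸ aux_le_hit T σ hσT _ ω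
  have hστ : ∀ ω, σ ω ≤ τσ ω := fun ω => hτσ ▸ aux_le_hit T σ hσT _ ω
  have hρF : ∀ ω, v (ρσ ω) ω = F (ρσ ω) ω := by
    intro ω
    rcases (hρT ω).eq_or_lt with h | h
    · rw [h, hvT]
    · rw [hρσ] at h ⊢
      exact aux_hit_prop T σ _ ω h
  have hτG : ∀ ω, τσ ω < T → v (τσ ω) ω = G (τσ ω) ω := by
    intro ω h
    rw [hτσ] at h ⊢
    exact aux_hit_prop T σ _ ω h
  have hρne : ∀ ω t, σ ω ≤ t → t < ρσ ω → v t ω ≠ F t ω := by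
    intro ω t h1 h2
    rw [hρσ] at h2
    exact aux_hit_not T σ _ ω t h1 h2
  have hτne : ∀ ω t, σ ω ≤ t → t < τσ ω → v t ω ≠ G t ω := by
    intro ω t h1 h2
    rw [hτσ] at h2
    exact aux_hit_not T σ _ ω t h1 h2
  -- upper bound
  have upper : ∀ ρ : Ω → ℕ, MemT 𝓕 T ρ → (∀ ω, σ ω ≤ ρ ω) →
      μ[dynkinGain F G ρ τσ | hσ.measurableSpace] ≤ᵐ[μ] (fun ω => v (σ ω) ω) := by
    rintro ρ ⟨hρ, hρT'⟩ hle
    have hmin := aux_min_stopping 𝓕 ρ τσ hρ hτs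
    have hminT : ∀ ω, min (ρ ω) (τσ ω) ≤ T := fun ω => (min_le_left _ _).trans (hρT' ω)
    have key := aux_sampling μ 𝓕 T (fun t => -u t) (fun t => (hum t).neg) (fun t => (hui t).neg)
      σ (fun ω => min (ρ ω) (τσ ω)) hσ hmin (fun ω => le_min (hle ω) (hστ ω)) hminT (by
        intro t
        filter_upwards [condExp_neg (μ := μ) (u (t + 1)) (𝓕 t), hvG] with ω hω hωG h1 h2
        rw [hω]
        have h3 : t < τσ ω := h2.trans_le (min_le_right _ _)
        have h4 : t < T := h3.trans_le (hτT ω)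
        rw [hu t h4.le, hu (t + 1) h4]
        simp only [Pi.neg_apply, neg_le_neg_iff]
        have h5 := lt_of_le_of_ne (hωG t h4) (hτne ω t h1 h3)
        have h6 := congrFun (hvrec t h4) ω
        have h7 : min (G t ω) ((μ[v (t + 1) | 𝓕 t]) ω) ≤ v t ω := h6 ▸ le_max_right _ _
        rcases min_le_iff.1 h7 with h8 | h8
        · exact absurd h8 (not_le.2 h5)
        · exact h8)
    have hgain : dynkinGain F G ρ τσ ≤ᵐ[μ] fun ω => u (min (ρ ω) (τσ ω)) ω := by
      refine Filter.Eventually.of_forall fun ω => ?_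
      show dynkinGain F G ρ τσ ω ≤ u (min (ρ ω) (τσ ω)) ω
      rw [hu _ (hminT ω)]
      unfold dynkinGain
      split_ifs with h
      · rw [min_eq_left h]; exact hFv _ (hρT' ω) ω
      · push Not at h
        rw [min_eq_right h.le, hτG ω (h.trans_le (hρT' ω))]
    have h1 := condExp_mono (m := hσ.measurableSpace)
      (aux_gain_integrable μ 𝓕 T F G hFi hGi ρ τσ hρ hτs hρT' hτT)
      (aux_integrable_stopped μ 𝓕 T u hui _ hmin hminT) hgain
    have h2 := condExp_neg (μ := μ) (fun ω => u (min (ρ ω) (τσ ω)) ω) hσ.measurableSpace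
    filter_upwards [key, h1, h2] with ω hk h1 h2
    have hk' : -u (σ ω) ω
        ≤ (μ[-(fun ω => u (min (ρ ω) (τσ ω)) ω) | hσ.measurableSpace]) ω := hk
    rw [h2, Pi.neg_apply, neg_le_neg_iff, hu _ (hσT ω)] at hk'
    exact h1.trans hk'
  have lower : ∀ τ : Ω → ℕ, MemT 𝓕 T τ → (∀ ω, σ ω ≤ τ ω) →
      (fun ω => v (σ ω) ω) ≤ᵐ[μ] μ[dynkinGain F G ρσ τ | hσ.measurableSpace] := by
    rintro τ ⟨hτ, hτT'⟩ hle
    have hmin := aux_min_stopping 𝓕 ρσ τ hρs hτ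
    have hminT : ∀ ω, min (ρσ ω) (τ ω) ≤ T := fun ω => (min_le_left _ _).trans (hρT ω)
    have key := aux_sampling μ 𝓕 T u hum hui
      σ (fun ω => min (ρσ ω) (τ ω)) hσ hmin (fun ω => le_min (hσρ ω) (hle ω)) hminT (by
        intro t
        refine Filter.Eventually.of_forall fun ω h1 h2 => ?_
        have h3 : t < ρσ ω := h2.trans_le (min_le_left _ _)
        have h4 : t < T := h3.trans_le (hρT ω)
        rw [hu t h4.le, hu (t + 1) h4]
        have h5 := lt_of_le_of_ne (hFv t h4.le ω) (hρne ω t h1 h3).symm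
        have h6 := congrFun (hvrec t h4) ω
        rcases max_choice (F t ω) (min (G t ω) ((μ[v (t + 1) | 𝓕 t]) ω)) with h7 | h7
        · rw [h7] at h6
          exact absurd h6 h5.ne'
        · rw [h6, h7]
          exact min_le_right _ _)
    have hgain : (fun ω => u (min (ρσ ω) (τ ω)) ω) ≤ᵐ[μ] dynkinGain F G ρσ τ := by
      filter_upwards [hvG] with ω hω
      rw [hu _ (hminT ω)]
      unfold dynkinGain
      split_ifs with h
      · rw [min_eq_left h]; exact (hρF ω).le
      · push Not at h
        rw [min_eq_right h.le]
        exact hω _ (h.trans_le (hρT ω))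
    have h1 := condExp_mono (m := hσ.measurableSpace)
      (aux_integrable_stopped μ 𝓕 T u hui _ hmin hminT)
      (aux_gain_integrable μ 𝓕 T F G hFi hGi ρσ τ hρs hτ hρT hτT') hgain
    filter_upwards [key, h1] with ω hk h1
    rw [hu _ (hσT ω)] at hk
    exact hk.trans h1
  have hU := upper ρσ ⟨hρs, hρT⟩ hσρ
  have hL := lower τσ ⟨hτs, hτT⟩ hστ
  exact ⟨fun ρ h1 h2 => (upper ρ h1 h2).trans hL, fun τ h1 h2 => hU.trans (lower τ h1 h2),
    hU.antisymm hL⟩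

end
end
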